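/- Let R be a commutative Noetherian integral domain, m a maximal ideal of R with residue field k = R/m, M a finitely generated R-module, and N a finite-dimensional k-vector space, regarded as an R-module via the quotient map R → k. Let f : M → N be an R-linear map whose kernel equals m·M, and suppose that the dimension of Frac(R) ⊗_R M over the fraction field Frac(R) equals the dimension of N over k. Then f is surjective. -/

import Mathlib

open TensorProduct

/-- If a submodule together with `I • M` generates a finite module `M`, then some element
congruent to `1` modulo `I` maps `M` into that submodule. -/
theorem Submodule.exists_sub_one_mem_and_smul_mem_of_sup_smul_top_eq_top {R M : Type*} [CommRing R]
    [AddCommGroup M] [Module R M] [Module.Finite R M] (I : Ideal R) (S : Submodule R M)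
    (h : S ⊔ I • (⊤ : Submodule R M) = ⊤) :
    ∃ r : R, r - 1 ∈ I ∧ ∀ x : M, r • x ∈ S := by
  have htop : (⊤ : Submodule R (M ⧸ S)) ≤ I • ⊤ := by
    have hmap := congrArg (Submodule.map S.mkQ) h
    rw [Submodule.map_sup, Submodule.map_smul'', Submodule.map_top, Submodule.range_mkQ,
      Submodule.mkQ_map_self, bot_sup_eq] at hmap
    exact hmap.ge
  obtain ⟨r, hr, hrS⟩ := Submodule.exists_sub_one_mem_and_smul_eq_zero_of_fg_of_le_smul I ⊤
    Module.Finite.fg_top htop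
  refine ⟨r, hr, fun x ↦ ?_⟩
  rw [← Submodule.Quotient.mk_eq_zero, Submodule.Quotient.mk_smul]
  exact hrS _ trivial

/-- If a nonzero scalar maps `M` into the span of `n` elements, then `M` has generic rank at most
`n`. -/
theorem finrank_fractionRing_tensorProduct_le_of_smul_mem_span {R M : Type*} [CommRing R]
    [IsDomain R] [AddCommGroup M] [Module R M] {ι : Type*} [Fintype ι] (x : ι → M) {r : R}
    (hr : r ≠ 0) (h : ∀ y : M, r • y ∈ Submodule.span R (Set.range x)) :
    Module.finrank (FractionRing R) (FractionRing R ⊗[R] M) ≤ Fintype.card ι := by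
  let e : ι → FractionRing R ⊗[R] M := fun i ↦ 1 ⊗ₜ x i
  have hmem (z : M) (hz : z ∈ Submodule.span R (Set.range x)) :
      (1 : FractionRing R) ⊗ₜ[R] z ∈ Submodule.span (FractionRing R) (Set.range e) := by
    induction hz using Submodule.span_induction with
    | mem z hz =>
      obtain ⟨i, rfl⟩ := hz
      exact Submodule.subset_span ⟨i, rfl⟩
    | zero => simp
    | add a b _ _ ha hb => rw [tmul_add]; exact add_mem ha hb
    | smul c a _ ha =>
      rw [tmul_smul, ← algebraMap_smul (FractionRing R) c]
      exact Submodule.smul_mem _ _ ha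
  have hr' : algebraMap R (FractionRing R) r ≠ 0 := by simpa using hr
  have hspan : Submodule.span (FractionRing R) (Set.range e) = ⊤ := by
    refine eq_top_iff.2 fun t _ ↦ ?_
    induction t using TensorProduct.induction_on with
    | zero => exact zero_mem _
    | add a b ha hb => exact add_mem (ha trivial) (hb trivial)
    | tmul a y =>
      have hay : a ⊗ₜ[R] y =
          (a * (algebraMap R (FractionRing R) r)⁻¹) • ((1 : FractionRing R) ⊗ₜ[R] (r • y)) := by
        rw [tmul_smul, ← algebraMap_smul (FractionRing R) r, smul_smul,
          inv_mul_cancel_right₀ hr', smul_tmul', smul_eq_mul, mul_one]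
      rw [hay]
      exact Submodule.smul_mem _ _ (hmem _ (h y))
  rw [← finrank_top, ← hspan]
  exact finrank_range_le_card e

/-- Let `R` be a commutative Noetherian integral domain, `m` a maximal ideal with residue
field `k = R ⧸ m`, `M` a finitely generated `R`-module, and `N` a finite-dimensional
`k`-vector space regarded as an `R`-module via the quotient map. If `f : M →ₗ[R] N` has
kernel `m • M` and `dim_{Frac R} (Frac R ⊗[R] M) = dim_k N`, then `f` is surjective. -/
theorem stmt_3 {R : Type*} [CommRing R] [IsDomain R] [IsNoetherianRing R]
    (m : Ideal R) [m.IsMaximal]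
    {M : Type*} [AddCommGroup M] [Module R M] [Module.Finite R M]
    {N : Type*} [AddCommGroup N] [Module (R ⧸ m) N] [Module R N]
    [IsScalarTower R (R ⧸ m) N] [Module.Finite (R ⧸ m) N]
    (f : M →ₗ[R] N)
    (hker : LinearMap.ker f = m • (⊤ : Submodule R M))
    (hdim : Module.finrank (FractionRing R) (FractionRing R ⊗[R] M)
      = Module.finrank (R ⧸ m) N) :
    Function.Surjective f := by
  let : Field (R ⧸ m) := Ideal.Quotient.field m
  have hspan (s : Set N) : (Submodule.span (R ⧸ m) s).restrictScalars R = Submodule.span R s :=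
    Submodule.restrictScalars_span R (R ⧸ m) Ideal.Quotient.mk_surjective s
  obtain ⟨v, hv, hvspan, -⟩ :=
    Submodule.exists_fun_fin_finrank_span_eq (R ⧸ m) (Set.range f)
  choose x hx using hv
  have hxv : f '' Set.range x = Set.range v := by
    rw [← Set.range_comp]
    exact congrArg Set.range (funext hx)
  have hrange : Submodule.span R (Set.range v) = LinearMap.range f := by
    rw [← hspan, hvspan, hspan, ← LinearMap.coe_range, Submodule.span_eq]
  have hsup : Submodule.span R (Set.range x) ⊔ m • (⊤ : Submodule R M) = ⊤ := by
    rw [← hker, ← Submodule.comap_map_eq, Submodule.map_span, hxv, hrange]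
    exact eq_top_iff.2 fun y _ ↦ ⟨y, rfl⟩
  obtain ⟨r, hr, hrx⟩ :=
    Submodule.exists_sub_one_mem_and_smul_mem_of_sup_smul_top_eq_top m _ hsup
  have hr0 : r ≠ 0 := by
    rintro rfl
    exact ‹m.IsMaximal›.ne_top (m.eq_top_iff_one.2 (by simpa using hr))
  have hle := finrank_fractionRing_tensorProduct_le_of_smul_mem_span x hr0 hrx
  rw [Fintype.card_fin, hdim] at hle
  have htop : Submodule.span (R ⧸ m) (Set.range f) = ⊤ :=
    Submodule.eq_top_of_finrank_eq (le_antisymm (Submodule.finrank_le _) hle)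
  rw [← LinearMap.range_eq_top, ← hrange, ← hspan, hvspan, htop, Submodule.restrictScalars_top]
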